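/- arXiv:2106.00083 — 12 statements merged into one kernel-verified Lean document; each statement's English description precedes it below -/
import Mathlib

section
/- For every n-dimensional AMM A and every point x in the state space of A (i.e. A(x) = 0), there exists a vector w ∈ ℝ^n with all coordinates strictly negative such that w · x > w · y for all y ∈ upper(A) with y ≠ x. -/
open Finset

/-- The positive orthant: points with all coordinates strictly positive. -/
def posOrthant (ι : Type*) [Fintype ι] : Set (ι → ℝ) := {x | ∀ i, 0 < x i}

/-- An AMM over the assets indexed by `ι`. -/
structure AMM (ι : Type*) [Fintype ι] where
  f : (ι → ℝ) → ℝ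
  contDiff : ContDiffOn ℝ 2 f (posOrthant ι)
  strictMono : ∀ x x', x ∈ posOrthant ι → x' ∈ posOrthant ι →
      x ≤ x' → x ≠ x' → f x < f x'
  upper_closed : IsClosed {x | x ∈ posOrthant ι ∧ 0 ≤ f x}
  upper_strictConvex : ∀ x x', x ∈ {y | y ∈ posOrthant ι ∧ 0 ≤ f y} →
      x' ∈ {y | y ∈ posOrthant ι ∧ 0 ≤ f y} → x ≠ x' → ∀ t : ℝ, 0 < t → t < 1 →
      t • x + (1 - t) • x' ∈ interior {y | y ∈ posOrthant ι ∧ 0 ≤ f y}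

/-- The upper contour set of an AMM. -/
def upperSet {ι : Type*} [Fintype ι] (A : AMM ι) : Set (ι → ℝ) :=
  {x | x ∈ posOrthant ι ∧ 0 ≤ A.f x}

/-- The state space of an AMM: the level set at 0. -/
def stateSpace {ι : Type*} [Fintype ι] (A : AMM ι) : Set (ι → ℝ) :=
  {x | x ∈ posOrthant ι ∧ A.f x = 0}

/-- A valuation: all coordinates in (0,1), summing to 1. -/
def IsValuation {ι : Type*} [Fintype ι] (v : ι → ℝ) : Prop :=
  (∀ i, 0 < v i ∧ v i < 1) ∧ ∑ i, v i = 1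

/-- The set of valuations (the interior of the standard simplex). -/
def valuations (ι : Type*) [Fintype ι] : Set (ι → ℝ) :=
  {v | IsValuation v}

/-- Dot product. -/
def dot {ι : Type*} [Fintype ι] (v x : ι → ℝ) : ℝ := ∑ i, v i * x i


theorem upperSet_convex {ι : Type*} [Fintype ι] (A : AMM ι) : Convex ℝ (upperSet A) := by
  intro a ha b hb s t hs ht hst
  rcases eq_or_ne a b with rfl | hab
  · rwa [← add_smul, hst, one_smul]
  rcases hs.eq_or_lt with rfl | hs
  · obtain rfl : t = 1 := by linarith
    simpa using hb
  rcases ht.eq_or_lt with rfl | ht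
  · obtain rfl : s = 1 := by linarith
    simpa using ha
  obtain rfl : t = 1 - s := by linarith
  exact interior_subset (A.upper_strictConvex a b ha hb hab s hs (by linarith))

theorem notMem_interior_upperSet {ι : Type*} [Fintype ι] [Nonempty ι] (A : AMM ι)
    {x : ι → ℝ} (hx : x ∈ stateSpace A) : x ∉ interior (upperSet A) := by
  intro h
  have hlim : Filter.Tendsto (fun ε : ℝ => x - fun _ => ε)
      (nhdsWithin 0 (Set.Ioi 0)) (nhds x) := by
    have hc : Continuous (fun ε : ℝ => x - fun _ => ε) := by fun_prop
    have h0 := hc.tendsto 0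
    have hz : (x - fun _ => (0 : ℝ)) = x := by ext; simp
    rw [hz] at h0
    exact h0.mono_left nhdsWithin_le_nhds
  obtain ⟨ε, hε, hpos⟩ := ((hlim.eventually (mem_interior_iff_mem_nhds.mp h)).and
    self_mem_nhdsWithin).exists
  have hε_pos : 0 < ε := hpos
  have hε_mem : (x - fun _ => ε) ∈ upperSet A := hε
  have hlt := A.strictMono (x - fun _ => ε) x hε_mem.1 hx.1
    (fun i => by simp [hε_pos.le])
    (fun heq => by
      have := congrFun heq (Classical.arbitrary ι)
      simp at this
      exact hε_pos.ne' this)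
  linarith [hε_mem.2, hx.2]

theorem add_single_mem_upperSet {ι : Type*} [Fintype ι] [DecidableEq ι] (A : AMM ι)
    {x : ι → ℝ} (hx : x ∈ upperSet A) (i : ι) : x + Pi.single i 1 ∈ upperSet A := by
  have hnonneg : (0 : ι → ℝ) ≤ Pi.single i 1 := Pi.single_nonneg.mpr zero_le_one
  have hpos : x + Pi.single i 1 ∈ posOrthant ι :=
    fun j => add_pos_of_pos_of_nonneg (hx.1 j) (hnonneg j)
  exact ⟨hpos, hx.2.trans (A.strictMono x _ hx.1 hpos (le_add_of_nonneg_right hnonneg)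
    (by simp)).le⟩

/-- For every point `x` of the state space there is a strictly negative vector `w`
such that `w · x > w · y` for all other points `y` of the upper contour set. -/
theorem exists_negative_supporting_vector (n : ℕ) (A : AMM (Fin n))
    (x : Fin n → ℝ) (hx : x ∈ stateSpace A) :
    ∃ w : Fin n → ℝ, (∀ i, w i < 0) ∧
      ∀ y ∈ upperSet A, y ≠ x → dot w y < dot w x := by
  classical
  rcases isEmpty_or_nonempty (Fin n) with hn | hn
  · exact ⟨0, fun i => isEmptyElim i, fun y _ hy => absurd (Subsingleton.elim y x) hy⟩
  have hxU : x ∈ upperSet A := ⟨hx.1, hx.2.ge⟩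
  obtain ⟨g, hg⟩ := geometric_hahn_banach_open_point (upperSet_convex A).interior
    isOpen_interior (notMem_interior_upperSet A hx)
  have hlt : ∀ y ∈ upperSet A, y ≠ x → g y < g x := by
    intro y hy hyx
    have h := hg _ (A.upper_strictConvex y x hy hxU hyx (1 / 2) (by norm_num) (by norm_num))
    simp only [map_add, map_smul, smul_eq_mul] at h
    linarith
  have hdot : ∀ y, dot (fun i => g (Pi.single i 1)) y = g y := by
    intro y
    conv_rhs => rw [pi_eq_sum_univ' y]
    simp [dot, mul_comm]
  refine ⟨fun i => g (Pi.single i 1), fun i => ?_, fun y hy hyx => ?_⟩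
  · have h := hlt _ (add_single_mem_upperSet A hxU i) (by simp)
    rw [map_add] at h
    linarith
  · rw [hdot, hdot]
    exact hlt y hy hyx
end

section
/- Let A be an (n+m)-dimensional AMM, viewed as a function A(x, y) of x ∈ ℝ_{>0}^n and y ∈ ℝ_{>0}^m, and let a ∈ ℝ_{>0}^n be fixed. Then the projection A_a : ℝ_{>0}^m → ℝ defined by A_a(y) = A(a, y) is an m-dimensional AMM: it is twice continuously differentiable, strictly increasing (y ≤ y' componentwise with y ≠ y' implies A_a(y) < A_a(y')), and its upper contour set {y ∈ ℝ_{>0}^m : A_a(y) ≥ 0} is closed in ℝ^m and strictly convex. -/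
open Finset

theorem sumElim_mem_posOrthant_iff {ι κ : Type*} [Fintype ι] [Fintype κ] {a : ι → ℝ}
    (ha : a ∈ posOrthant ι) (y : κ → ℝ) :
    Sum.elim a y ∈ posOrthant (ι ⊕ κ) ↔ y ∈ posOrthant κ := by
  simpa [posOrthant] using fun _ => ha

theorem contDiff_sumElim {ι κ : Type*} [Fintype ι] [Fintype κ] (a : ι → ℝ) (n : WithTop ℕ∞) :
    ContDiff ℝ n fun y : κ → ℝ => (Sum.elim a y : ι ⊕ κ → ℝ) := by
  refine contDiff_pi.2 ?_
  rintro (i | j)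
  · exact contDiff_const
  · exact contDiff_apply ℝ ℝ j

/-- The projection of an `(n+m)`-dimensional AMM onto fixed first coordinates
`a` is an `m`-dimensional AMM: letting `Aa y = A (a, y)`, the function `Aa` is
twice continuously differentiable, strictly increasing, and its upper contour
set is closed and strictly convex. -/
theorem projection_is_AMM (n m : ℕ) (A : AMM (Fin n ⊕ Fin m))
    (a : Fin n → ℝ) (ha : a ∈ posOrthant (Fin n))
    (Aa : (Fin m → ℝ) → ℝ) (hAa : Aa = fun y => A.f (Sum.elim a y)) :
    ContDiffOn ℝ 2 Aa (posOrthant (Fin m)) ∧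
    (∀ y y', y ∈ posOrthant (Fin m) → y' ∈ posOrthant (Fin m) →
      y ≤ y' → y ≠ y' → Aa y < Aa y') ∧
    IsClosed {y | y ∈ posOrthant (Fin m) ∧ 0 ≤ Aa y} ∧
    (∀ y y', y ∈ {u | u ∈ posOrthant (Fin m) ∧ 0 ≤ Aa u} →
      y' ∈ {u | u ∈ posOrthant (Fin m) ∧ 0 ≤ Aa u} → y ≠ y' →
      ∀ t : ℝ, 0 < t → t < 1 →
      t • y + (1 - t) • y' ∈ interior {u | u ∈ posOrthant (Fin m) ∧ 0 ≤ Aa u}) := by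
  subst hAa
  have hpos := sumElim_mem_posOrthant_iff (κ := Fin m) ha
  have hcont : Continuous fun y : Fin m → ℝ => (Sum.elim a y : Fin n ⊕ Fin m → ℝ) :=
    (contDiff_sumElim a 2).continuous
  have hinj : Function.Injective fun y : Fin m → ℝ => (Sum.elim a y : Fin n ⊕ Fin m → ℝ) :=
    fun y y' h => funext fun j => congrFun h (Sum.inr j)
  have hpre : {u | u ∈ posOrthant (Fin m) ∧ 0 ≤ A.f (Sum.elim a u)} =
      (fun y => Sum.elim a y) ⁻¹' {x | x ∈ posOrthant (Fin n ⊕ Fin m) ∧ 0 ≤ A.f x} := by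
    ext u
    simp [hpos]
  refine ⟨A.contDiff.comp (contDiff_sumElim a 2).contDiffOn fun y hy => (hpos y).2 hy, ?_, ?_, ?_⟩
  · intro y y' hy hy' hle hne
    refine A.strictMono _ _ ((hpos y).2 hy) ((hpos y').2 hy') ?_ (hinj.ne hne)
    rintro (i | j)
    · exact le_rfl
    · exact hle j
  · rw [hpre]
    exact A.upper_closed.preimage hcont
  · intro y y' hy hy' hne t ht ht'
    rw [hpre] at hy hy' ⊢
    apply preimage_interior_subset_interior_preimage hcont
    have h := A.upper_strictConvex _ _ hy hy' (hinj.ne hne) t ht ht'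
    rw [Set.mem_preimage]
    convert h using 1
    ext (i | j)
    · simp [← add_mul]
    · simp
end

section
/- Let A be an (n+m)-dimensional AMM, viewed as a function A(x, y) of x ∈ ℝ_{>0}^n and y ∈ ℝ_{>0}^m, let v ∈ int(Δ^{n+m}) be a valuation on the n+m assets, written v = (v_1, …, v_{n+m}), and suppose (a, b) with a ∈ ℝ_{>0}^n, b ∈ ℝ_{>0}^m is the stable point for v in the state space of A. Then b is a stable point for the inherited valuation v' = (v_{n+1}, …, v_{n+m}) / (Σ_{k=n+1}^{n+m} v_k) in the state space {y ∈ ℝ_{>0}^m : A(a, y) = 0} of the projection A_a(y) = A(a, y): that is, v' · b ≤ v' · y for all y ∈ ℝ_{>0}^m with A(a, y) = 0. -/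
open Finset

/-- Stable points persist under projection: if `(a, b)` is the stable point of an
`(n+m)`-dimensional AMM `A` for valuation `v`, then `b` is a stable point of the
projection `A_a` for the inherited valuation `v'`. -/
theorem projection_stable_point (n m : ℕ) (A : AMM (Fin n ⊕ Fin m))
    (v : Fin n ⊕ Fin m → ℝ) (hv : IsValuation v)
    (a : Fin n → ℝ) (b : Fin m → ℝ)
    (hab : Sum.elim a b ∈ stateSpace A)
    (hstable : ∀ z ∈ stateSpace A, dot v (Sum.elim a b) ≤ dot v z)
    (v' : Fin m → ℝ) (hv' : v' = fun j => v (Sum.inr j) / ∑ k, v (Sum.inr k)) :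
    ∀ y : Fin m → ℝ, y ∈ posOrthant (Fin m) → A.f (Sum.elim a y) = 0 →
      dot v' b ≤ dot v' y := by
  intro y hy hAy
  have hmem : Sum.elim a y ∈ stateSpace A := by
    refine ⟨?_, hAy⟩
    rintro (i | j)
    · exact hab.1 (Sum.inl i)
    · exact hy j
  have h := hstable _ hmem
  simp only [dot, Fintype.sum_sum_type, Sum.elim_inl, Sum.elim_inr, add_le_add_iff_left] at h
  have hS : 0 ≤ ∑ k, v (Sum.inr k) := Finset.sum_nonneg fun k _ => (hv.1 (Sum.inr k)).1.le
  simp only [hv', dot, div_mul_eq_mul_div, ← Finset.sum_div]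
  exact div_le_div_of_nonneg_right h hS
end

section
/- Let A be an (m+n)-dimensional AMM, viewed as a function A(x, y) of x ∈ ℝ_{>0}^m and y ∈ ℝ_{>0}^n, in state (a, b) (so A(a, b) = 0), and let v ∈ int(Δ^n) be a valuation on the last n assets. Then for every a' ∈ ℝ_{>0}^m such that the slice {a'} × ℝ_{>0}^n meets the state space of A (i.e. there exists b' ∈ ℝ_{>0}^n with A(a', b') = 0), there is a unique t ∈ ℝ such that b + t·v ∈ ℝ_{>0}^n and A(a', b + t·v) = 0. -/
open Finset

theorem isOpen_posOrthant (ι : Type*) [Fintype ι] : IsOpen (posOrthant ι) := by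
  simp only [posOrthant, Set.ofPred_forall]
  exact isOpen_iInter_of_finite fun i => isOpen_lt continuous_const (continuous_apply i)

theorem sumElim_mem_posOrthant {ι κ : Type*} [Fintype ι] [Fintype κ] {x : ι → ℝ} {y : κ → ℝ} :
    Sum.elim x y ∈ posOrthant (ι ⊕ κ) ↔ x ∈ posOrthant ι ∧ y ∈ posOrthant κ := by
  simp [posOrthant]

theorem AMM.f_mono {ι : Type*} [Fintype ι] (A : AMM ι) {x y : ι → ℝ}
    (hx : x ∈ posOrthant ι) (hy : y ∈ posOrthant ι) (hxy : x ≤ y) : A.f x ≤ A.f y := by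
  rcases eq_or_ne x y with rfl | hne
  · rfl
  · exact (A.strictMono x y hx hy hxy hne).le

theorem AMM.continuousAt_f {ι : Type*} [Fintype ι] (A : AMM ι) {x : ι → ℝ}
    (hx : x ∈ posOrthant ι) : ContinuousAt A.f x :=
  A.contDiff.continuousOn.continuousAt ((isOpen_posOrthant ι).mem_nhds hx)

theorem continuous_sumElim_add_smul {ι κ : Type*} (x : ι → ℝ) (y v : κ → ℝ) :
    Continuous fun t : ℝ => Sum.elim x (y + t • v) := by
  refine continuous_pi fun i => ?_
  rcases i with i | j
  · exact continuous_const
  · simp only [Sum.elim_inr, Pi.add_apply, Pi.smul_apply, smul_eq_mul]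
    fun_prop

/-- A ray in a direction with positive coordinates eventually dominates any given point. -/
theorem exists_le_add_smul {ι : Type*} [Finite ι] (y z v : ι → ℝ) (hv : ∀ i, 0 < v i) :
    ∃ t : ℝ, z ≤ y + t • v := by
  have h : ∀ᶠ t : ℝ in Filter.atTop, ∀ i, z i ≤ y i + t * v i :=
    Filter.eventually_all.2 fun i =>
      (Filter.tendsto_atTop_add_const_left _ (y i)
        (Filter.tendsto_id.atTop_mul_const (hv i))).eventually_ge_atTop (z i)
  exact h.exists

/-- Virtualization: if `A` is an `(m+n)`-dimensional AMM in state `(a, b)` and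
`v` is a valuation on the last `n` assets, then for every `a'` in the positive
orthant whose slice meets the state space of `A`, there is a unique `t ∈ ℝ`
such that `b + t • v` is positive and `(a', b + t • v)` lies in the state
space of `A`. -/
theorem virtualization_unique_t (m n : ℕ) (A : AMM (Fin m ⊕ Fin n))
    (a : Fin m → ℝ) (b : Fin n → ℝ) (hab : Sum.elim a b ∈ stateSpace A)
    (v : Fin n → ℝ) (hv : IsValuation v) :
    ∀ a' : Fin m → ℝ, a' ∈ posOrthant (Fin m) →
      (∃ b' : Fin n → ℝ, b' ∈ posOrthant (Fin n) ∧ A.f (Sum.elim a' b') = 0) →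
      ∃! t : ℝ, (b + t • v) ∈ posOrthant (Fin n) ∧
        A.f (Sum.elim a' (b + t • v)) = 0 := by
  intro a' ha' ⟨b', hb', hfb'⟩
  have hvpos : ∀ i, 0 < v i := fun i => (hv.1 i).1
  obtain ⟨i₀⟩ : Nonempty (Fin n) := by
    by_contra h
    rw [not_nonempty_iff] at h
    simpa using hv.2
  have hg := continuous_sumElim_add_smul a' b v
  set g : ℝ → Fin m ⊕ Fin n → ℝ := fun t => Sum.elim a' (b + t • v) with hg_def
  have hmem : ∀ t, g t ∈ posOrthant _ ↔ b + t • v ∈ posOrthant _ := fun t => by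
    simp [hg_def, sumElim_mem_posOrthant, ha']
  have hlt : ∀ s t : ℝ, s < t → g s ∈ posOrthant _ → g t ∈ posOrthant _ →
      A.f (g s) < A.f (g t) := by
    intro s t hst hs ht
    have key : ∀ i, s * v i < t * v i := fun i => mul_lt_mul_of_pos_right hst (hvpos i)
    refine A.strictMono _ _ hs ht ?_ fun h => ?_
    · rintro (i | j)
      · exact le_rfl
      · simpa [hg_def] using (key j).le
    · have := congrFun h (Sum.inr i₀)
      simp only [hg_def, Sum.elim_inr, Pi.add_apply, Pi.smul_apply, smul_eq_mul] at this
      linarith [key i₀]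
  let S : Set ℝ := g ⁻¹' upperSet A
  have hSclosed : IsClosed S := A.upper_closed.preimage hg
  have hSne : S.Nonempty := by
    obtain ⟨t, ht⟩ := exists_le_add_smul b b' v hvpos
    have hpos : g t ∈ posOrthant _ := (hmem t).2 fun i => (hb' i).trans_le (ht i)
    refine ⟨t, hpos, hfb' ▸ A.f_mono (sumElim_mem_posOrthant.2 ⟨ha', hb'⟩) hpos ?_⟩
    rintro (i | j)
    · exact le_rfl
    · exact ht j
  have hSbdd : BddBelow S := by
    refine ⟨-b i₀ / v i₀, fun t ht => ?_⟩
    have h := (hmem t).1 ht.1 i₀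
    simp only [Pi.add_apply, Pi.smul_apply, smul_eq_mul] at h
    rw [div_le_iff₀ (hvpos i₀)]
    linarith
  obtain ⟨hpos, hnonneg⟩ : sInf S ∈ S := hSclosed.csInf_mem hSne hSbdd
  refine ⟨sInf S, ⟨(hmem _).1 hpos, ?_⟩, ?_⟩
  · refine (eq_or_lt_of_le hnonneg).elim Eq.symm fun hf => ?_
    have hS : S ∈ nhds (sInf S) := by
      filter_upwards [hg.continuousAt.preimage_mem_nhds ((isOpen_posOrthant _).mem_nhds hpos),
        ((A.continuousAt_f hpos).comp hg.continuousAt).eventually (lt_mem_nhds hf)] with t h₁ h₂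
      exact ⟨h₁, h₂.le⟩
    obtain ⟨l, hl, hlS⟩ := exists_Ioc_subset_of_mem_nhds hS ⟨_, sub_one_lt _⟩
    obtain ⟨t, hlt', ht⟩ := exists_between hl
    exact absurd (csInf_le hSbdd (hlS ⟨hlt', ht.le⟩)) ht.not_ge
  · rintro t ⟨ht, hft⟩
    have ht' := (hmem t).2 ht
    have hS : t ∈ S := ⟨ht', hft.ge⟩
    refine (csInf_le hSbdd hS).antisymm' (le_of_not_gt fun h => ?_)
    exact absurd ((hlt _ _ h hpos ht').trans_eq hft) hnonneg.not_gt
end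

section
/- Let A be an (n+m)-dimensional AMM, viewed as a function A(x, y) of x ∈ ℝ_{>0}^n and y ∈ ℝ_{>0}^m, let v ∈ int(Δ^m) be a valuation, and let r ∈ ℝ^m with r ≥ 0 componentwise. Then the virtualized function (A|v) : ℝ_{>0}^n × ℝ_{>0} → ℝ defined by (A|v)(x, z) = A(x, z·v + r) is an (n+1)-dimensional AMM: it is twice continuously differentiable, strictly increasing ((x, z) ≤ (x', z') componentwise with (x, z) ≠ (x', z') implies (A|v)(x, z) < (A|v)(x', z')), and its upper contour set {(x, z) ∈ ℝ_{>0}^n × ℝ_{>0} : (A|v)(x, z) ≥ 0} is strictly convex. -/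
open Finset

/-- The reserves `(x, z • v + r)` represented by a virtualized state `(x, z)`. -/
def virtualReserves {ι κ : Type*} (v r : κ → ℝ) (p : (ι → ℝ) × ℝ) : ι ⊕ κ → ℝ :=
  Sum.elim p.1 (fun i => p.2 * v i + r i)

section virtualReserves

variable {ι κ : Type*} {v r : κ → ℝ}

theorem contDiff_virtualReserves [Fintype ι] [Fintype κ] {k : WithTop ℕ∞} :
    ContDiff ℝ k (virtualReserves v r : (ι → ℝ) × ℝ → ι ⊕ κ → ℝ) := by
  rw [contDiff_pi]
  rintro (i | i) <;> simp only [virtualReserves, Sum.elim_inl, Sum.elim_inr] <;> fun_prop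

theorem virtualReserves_mem_posOrthant [Fintype ι] [Fintype κ]
    (hv : ∀ i, 0 < v i) (hr : ∀ i, 0 ≤ r i)
    {p : (ι → ℝ) × ℝ} (hp : p.1 ∈ posOrthant ι ∧ 0 < p.2) :
    virtualReserves v r p ∈ posOrthant (ι ⊕ κ) := by
  rintro (i | i)
  · exact hp.1 i
  · exact add_pos_of_pos_of_nonneg (mul_pos hp.2 (hv i)) (hr i)

theorem virtualReserves_monotone (hv : ∀ i, 0 ≤ v i) :
    Monotone (virtualReserves v r : (ι → ℝ) × ℝ → ι ⊕ κ → ℝ) := by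
  rintro p q h (i | i)
  · exact h.1 i
  · exact add_le_add_left (mul_le_mul_of_nonneg_right h.2 (hv i)) (r i)

theorem virtualReserves_injective (hv : ∃ i, v i ≠ 0) :
    Function.Injective (virtualReserves v r : (ι → ℝ) × ℝ → ι ⊕ κ → ℝ) := by
  obtain ⟨j, hj⟩ := hv
  intro p q h
  refine Prod.ext (funext fun i => congrFun h (Sum.inl i)) ?_
  exact mul_right_cancel₀ hj (add_right_cancel (congrFun h (Sum.inr j)))

theorem virtualReserves_combo (p q : (ι → ℝ) × ℝ) (t : ℝ) :
    virtualReserves v r (t • p + (1 - t) • q) =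
      t • virtualReserves v r p + (1 - t) • virtualReserves v r q := by
  ext (i | i) <;> simp [virtualReserves]
  ring

end virtualReserves

theorem IsValuation.exists_ne_zero {ι : Type*} [Fintype ι] {v : ι → ℝ} (hv : IsValuation v) :
    ∃ i, v i ≠ 0 := by
  by_contra! h
  simpa [h] using hv.2

/-- Virtualizing the last `m` assets of an `(n+m)`-dimensional AMM with respect
to a valuation `v` and residue `r ≥ 0` yields an `(n+1)`-dimensional AMM:
`(A|v)(x, z) = A(x, z • v + r)` is twice continuously differentiable, strictly
increasing, and has a strictly convex upper contour set. -/
theorem virtualized_is_AMM (n m : ℕ) (A : AMM (Fin n ⊕ Fin m))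
    (v : Fin m → ℝ) (hv : IsValuation v)
    (r : Fin m → ℝ) (hr : ∀ i, 0 ≤ r i)
    (Av : (Fin n → ℝ) × ℝ → ℝ)
    (hAv : Av = fun p => A.f (Sum.elim p.1 (fun i => p.2 * v i + r i))) :
    ContDiffOn ℝ 2 Av {p | p.1 ∈ posOrthant (Fin n) ∧ 0 < p.2} ∧
    (∀ p p' : (Fin n → ℝ) × ℝ,
      p ∈ {q : (Fin n → ℝ) × ℝ | q.1 ∈ posOrthant (Fin n) ∧ 0 < q.2} →
      p' ∈ {q : (Fin n → ℝ) × ℝ | q.1 ∈ posOrthant (Fin n) ∧ 0 < q.2} →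
      p ≤ p' → p ≠ p' → Av p < Av p') ∧
    (∀ p p' : (Fin n → ℝ) × ℝ,
      p ∈ {q : (Fin n → ℝ) × ℝ | (q.1 ∈ posOrthant (Fin n) ∧ 0 < q.2) ∧ 0 ≤ Av q} →
      p' ∈ {q : (Fin n → ℝ) × ℝ | (q.1 ∈ posOrthant (Fin n) ∧ 0 < q.2) ∧ 0 ≤ Av q} →
      p ≠ p' → ∀ t : ℝ, 0 < t → t < 1 →
      t • p + (1 - t) • p' ∈
        interior {q : (Fin n → ℝ) × ℝ | (q.1 ∈ posOrthant (Fin n) ∧ 0 < q.2) ∧ 0 ≤ Av q}) := by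
  have hpos : ∀ i, 0 < v i := fun i => (hv.1 i).1
  replace hAv : Av = A.f ∘ virtualReserves v r := hAv
  subst hAv
  have hinj := virtualReserves_injective (ι := Fin n) (r := r) hv.exists_ne_zero
  refine ⟨?_, ?_, ?_⟩
  · exact A.contDiff.comp contDiff_virtualReserves.contDiffOn
      fun p hp => virtualReserves_mem_posOrthant hpos hr hp
  · intro p p' hp hp' hle hne
    exact A.strictMono _ _ (virtualReserves_mem_posOrthant hpos hr hp)
      (virtualReserves_mem_posOrthant hpos hr hp')
      (virtualReserves_monotone (fun i => (hpos i).le) hle) (hinj.ne hne)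
  · rintro p p' ⟨hp, hAp⟩ ⟨hp', hAp'⟩ hne t ht ht1
    have hint := A.upper_strictConvex _ _ ⟨virtualReserves_mem_posOrthant hpos hr hp, hAp⟩
      ⟨virtualReserves_mem_posOrthant hpos hr hp', hAp'⟩ (hinj.ne hne) t ht ht1
    rw [← virtualReserves_combo] at hint
    have hcont : Continuous (virtualReserves v r : (Fin n → ℝ) × ℝ → Fin n ⊕ Fin m → ℝ) :=
      (contDiff_virtualReserves (k := 0)).continuous
    rw [mem_interior]
    refine ⟨{q | q.1 ∈ posOrthant (Fin n) ∧ 0 < q.2} ∩ virtualReserves v r ⁻¹'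
      interior {y | y ∈ posOrthant (Fin n ⊕ Fin m) ∧ 0 ≤ A.f y}, ?_, ?_, ⟨⟨?_, ?_⟩, hint⟩⟩
    · exact fun q hq => ⟨hq.1, (interior_subset hq.2).2⟩
    · exact (((isOpen_posOrthant _).preimage continuous_fst).inter
        (isOpen_lt continuous_const continuous_snd)).inter (isOpen_interior.preimage hcont)
    · exact fun i => add_pos (mul_pos ht (hp.1 i)) (mul_pos (sub_pos.2 ht1) (hp'.1 i))
    · exact add_pos (mul_pos ht hp.2) (mul_pos (sub_pos.2 ht1) hp'.2)
end

section
/- Let f, g : ℝ_{>0} → ℝ_{>0} be twice continuously differentiable, strictly decreasing, and strictly convex, and let a, b ∈ ℝ_{>0}. Define h(x) = g(b + f(a) − f(x)) on the set D = {x ∈ ℝ_{>0} : b + f(a) − f(x) > 0}. Then h is twice continuously differentiable, strictly decreasing, and strictly convex on D; equivalently, the sequential composition (A ⊗ B)(x, y) = y − h(x) is twice differentiable and strictly increasing, and its upper contour set {(x, y) : x ∈ D, y > 0, y ≥ h(x)} is strictly convex. -/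
/-- Sequential composition of two 2-dimensional AMMs in explicit form:
if `f, g : ℝ_{>0} → ℝ_{>0}` are C², strictly decreasing and strictly convex,
then `h(x) = g(b + f(a) - f(x))` is C², strictly decreasing and strictly convex
on its natural domain `D = {x > 0 | b + f(a) - f(x) > 0}`. -/
theorem sequential_composition_is_AMM
    (f g : ℝ → ℝ) (a b : ℝ) (ha : 0 < a) (hb : 0 < b)
    (hfpos : ∀ x ∈ Set.Ioi (0 : ℝ), 0 < f x)
    (hgpos : ∀ y ∈ Set.Ioi (0 : ℝ), 0 < g y)
    (hf : ContDiffOn ℝ 2 f (Set.Ioi 0)) (hg : ContDiffOn ℝ 2 g (Set.Ioi 0))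
    (hfdec : StrictAntiOn f (Set.Ioi 0)) (hgdec : StrictAntiOn g (Set.Ioi 0))
    (hfconv : StrictConvexOn ℝ (Set.Ioi 0) f)
    (hgconv : StrictConvexOn ℝ (Set.Ioi 0) g)
    (h : ℝ → ℝ) (hh : h = fun x => g (b + f a - f x))
    (D : Set ℝ) (hD : D = {x : ℝ | 0 < x ∧ 0 < b + f a - f x}) :
    ContDiffOn ℝ 2 h D ∧ StrictAntiOn h D ∧ StrictConvexOn ℝ D h := by
  subst hh hD
  refine ⟨?_, ?_, ?_, ?_⟩
  · exact hg.comp (contDiffOn_const.sub (hf.mono fun x hx => hx.1)) fun x hx => hx.2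
  · rintro x ⟨hx, hux⟩ y ⟨hy, huy⟩ hxy
    exact hgdec hux huy (sub_lt_sub_left (hfdec hx hy hxy) _)
  · simpa only [Set.sep_mem_eq, Set.mem_Ioi, sub_pos] using! hfconv.convexOn.convex_lt (b + f a)
  · rintro x ⟨hx, hux⟩ y ⟨hy, huy⟩ hxy s t hs ht hst
    have hconcave : s * (b + f a - f x) + t * (b + f a - f y) < b + f a - f (s • x + t • y) := by
      have := hfconv.2 hx hy hxy hs ht hst
      simp only [smul_eq_mul] at this ⊢
      linear_combination this + (b + f a) * hst
    have hmean : 0 < s * (b + f a - f x) + t * (b + f a - f y) :=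
      add_pos (mul_pos hs hux) (mul_pos ht huy)
    exact (hgdec hmean (hmean.trans hconcave) hconcave).trans_le
      (hgconv.convexOn.2 hux huy hs.le ht.le hst)
end

section
/- Let f, g : ℝ_{>0} → ℝ_{>0} be twice continuously differentiable, strictly decreasing, and strictly convex, let a, b ∈ ℝ_{>0}, and let h(x) = g(b + f(a) − f(x)) wherever b + f(a) − f(x) > 0. Let (v, w, v') be a valuation on three assets (0 < v, w, v' < 1 and v + w + v' = 1). Suppose a is a stable point of (x, f(x)) for (v, w), i.e. v·a + w·f(a) < v·x + w·f(x) for all x ∈ ℝ_{>0} with x ≠ a, and b is a stable point of (y, g(y)) for (w, v'), i.e. w·b + v'·g(b) < w·y + v'·g(y) for all y ∈ ℝ_{>0} with y ≠ b. Then a is a stable point of the composed curve (x, h(x)) for (v, v'): v·a + v'·h(a) < v·x + v'·h(x) for all x ≠ a in the domain of h. -/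
/-- Stable points under sequential composition of 2-dimensional AMMs: if `a` is
the stable point of `(x, f(x))` for weights `(v, w)` and `b` is the stable
point of `(y, g(y))` for weights `(w, v')`, then `a` is the stable point of the
composed curve `(x, h(x))`, `h(x) = g(b + f(a) - f(x))`, for weights `(v, v')`. -/
theorem sequential_composition_stable_point
    (f g : ℝ → ℝ) (a b : ℝ) (ha : 0 < a) (hb : 0 < b)
    (hfpos : ∀ x ∈ Set.Ioi (0 : ℝ), 0 < f x)
    (hgpos : ∀ y ∈ Set.Ioi (0 : ℝ), 0 < g y)
    (hf : ContDiffOn ℝ 2 f (Set.Ioi 0)) (hg : ContDiffOn ℝ 2 g (Set.Ioi 0))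
    (hfdec : StrictAntiOn f (Set.Ioi 0)) (hgdec : StrictAntiOn g (Set.Ioi 0))
    (hfconv : StrictConvexOn ℝ (Set.Ioi 0) f)
    (hgconv : StrictConvexOn ℝ (Set.Ioi 0) g)
    (v w v' : ℝ) (hv : 0 < v ∧ v < 1) (hw : 0 < w ∧ w < 1)
    (hv' : 0 < v' ∧ v' < 1) (hsum : v + w + v' = 1)
    (hstableA : ∀ x : ℝ, 0 < x → x ≠ a → v * a + w * f a < v * x + w * f x)
    (hstableB : ∀ y : ℝ, 0 < y → y ≠ b → w * b + v' * g b < w * y + v' * g y)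
    (h : ℝ → ℝ) (hh : h = fun x => g (b + f a - f x)) :
    ∀ x : ℝ, 0 < x → 0 < b + f a - f x → x ≠ a →
      v * a + v' * h a < v * x + v' * h x := by
  intro x hx hy hxa
  subst hh
  have hA := hstableA x hx hxa
  have hB : w * b + v' * g b ≤ w * (b + f a - f x) + v' * g (b + f a - f x) := by
    by_cases hyb : b + f a - f x = b
    · rw [hyb]
    · exact (hstableB _ hy hyb).le
  simp only [add_sub_cancel_right]
  linarith
end

section
/- Let f : ℝ_{>0}^m → ℝ_{>0} and g : ℝ_{>0} × ℝ_{>0}^{n−1} → ℝ_{>0} be twice continuously differentiable, strictly decreasing (u ≤ u' componentwise with u ≠ u' implies f(u) > f(u'), and likewise for g), and strictly convex. Fix a ∈ ℝ_{>0}^m and c ∈ ℝ_{>0}, and define h(x, y) = g(c + f(a) − f(x), y) on the set D = {(x, y) ∈ ℝ_{>0}^m × ℝ_{>0}^{n−1} : c + f(a) − f(x) > 0}. Then h is twice continuously differentiable and strictly convex on D, and the many-to-one sequential composition (A ⊗ B)(x, y, z) = z − h(x, y) is strictly increasing: (x', y', z') ≥ (x, y, z) componentwise with (x', y', z') ≠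 (x, y, z) implies z' − h(x', y') > z − h(x, y). -/
open Finset

/-- Substituting `C - f` for the first argument of a strictly convex function `g` that is strictly
decreasing in that argument gives a strictly convex function when `f` is strictly convex. -/
theorem StrictConvexOn.comp_const_sub_fst {E F : Type*} [AddCommGroup E] [Module ℝ E]
    [AddCommGroup F] [Module ℝ F] {s : Set E} {t : Set F} {f : E → ℝ} {g : ℝ × F → ℝ} (C : ℝ)
    (hf : StrictConvexOn ℝ s f) (hg : StrictConvexOn ℝ (Set.Ioi 0 ×ˢ t) g)
    (ht : Convex ℝ t) (hanti : ∀ y ∈ t, StrictAntiOn (fun w => g (w, y)) (Set.Ioi 0)) :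
    StrictConvexOn ℝ {p : E × F | p.1 ∈ s ∧ p.2 ∈ t ∧ 0 < C - f p.1}
      (fun p => g (C - f p.1, p.2)) := by
  have sub_combo_le {x x' : E} (hx : x ∈ s) (hx' : x' ∈ s) {α β : ℝ} (hα : 0 ≤ α) (hβ : 0 ≤ β)
      (hαβ : α + β = 1) :
      α * (C - f x) + β * (C - f x') ≤ C - f (α • x + β • x') := by
    have := hf.convexOn.2 hx hx' hα hβ hαβ
    simp only [smul_eq_mul] at this
    linear_combination this + C * hαβ
  refine ⟨?_, ?_⟩
  · rintro ⟨x, y⟩ ⟨hx, hy, hw⟩ ⟨x', y'⟩ ⟨hx', hy', hw'⟩ α β hα hβ hαβ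
    exact ⟨hf.1 hx hx' hα hβ hαβ, ht hy hy' hα hβ hαβ,
      (convex_Ioi (0 : ℝ) hw hw' hα hβ hαβ).trans_le (sub_combo_le hx hx' hα hβ hαβ)⟩
  · rintro ⟨x, y⟩ ⟨hx, hy, hw⟩ ⟨x', y'⟩ ⟨hx', hy', hw'⟩ hne α β hα hβ hαβ
    have hpos : 0 < α * (C - f x) + β * (C - f x') :=
      convex_Ioi (0 : ℝ) hw hw' hα.le hβ.le hαβ
    have hle := sub_combo_le hx hx' hα.le hβ.le hαβ
    have hyt := ht hy hy' hα.le hβ.le hαβ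
    have hp : (C - f x, y) ∈ Set.Ioi (0 : ℝ) ×ˢ t := ⟨hw, hy⟩
    have hp' : (C - f x', y') ∈ Set.Ioi (0 : ℝ) ×ˢ t := ⟨hw', hy'⟩
    change g (C - f (α • x + β • x'), α • y + β • y') <
      α • g (C - f x, y) + β • g (C - f x', y')
    by_cases hxx : x = x'
    · subst hxx
      have hyy : (C - f x, y) ≠ (C - f x, y') := fun h => hne (by simpa using h)
      exact ((hanti _ hyt).antitoneOn hpos (hpos.trans_le hle) hle).trans_lt
        (hg.2 hp hp' hyy hα hβ hαβ)
    · have hlt : α * (C - f x) + β * (C - f x') < C - f (α • x + β • x') := by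
        have := hf.2 hx hx' hxx hα hβ hαβ
        simp only [smul_eq_mul] at this
        linear_combination this + C * hαβ
      exact (hanti _ hyt hpos (hpos.trans hlt) hlt).trans_le
        (hg.convexOn.2 hp hp' hα.le hβ.le hαβ)

/-- Many-to-one sequential composition: with `f : ℝ_{>0}^m → ℝ_{>0}` and
`g : ℝ_{>0} × ℝ_{>0}^{n-1} → ℝ_{>0}` (here `k = n - 1`) twice continuously
differentiable, strictly decreasing and strictly convex, the composed function
`h(x, y) = g(c + f(a) - f(x), y)` is twice continuously differentiable and
strictly convex on its domain `D`, and `(x, y, z) ↦ z - h(x, y)` is strictly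
increasing. -/
theorem many_to_one_composition_is_AMM (m k : ℕ)
    (f : (Fin m → ℝ) → ℝ) (g : ℝ × (Fin k → ℝ) → ℝ)
    (hfpos : ∀ u : Fin m → ℝ, (∀ i, 0 < u i) → 0 < f u)
    (hgpos : ∀ p : ℝ × (Fin k → ℝ), 0 < p.1 → (∀ j, 0 < p.2 j) → 0 < g p)
    (hf : ContDiffOn ℝ 2 f {u : Fin m → ℝ | ∀ i, 0 < u i})
    (hg : ContDiffOn ℝ 2 g {p : ℝ × (Fin k → ℝ) | 0 < p.1 ∧ ∀ j, 0 < p.2 j})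
    (hfdec : ∀ u u' : Fin m → ℝ, (∀ i, 0 < u i) → (∀ i, 0 < u' i) →
      u ≤ u' → u ≠ u' → f u' < f u)
    (hgdec : ∀ p p' : ℝ × (Fin k → ℝ), (0 < p.1 ∧ ∀ j, 0 < p.2 j) →
      (0 < p'.1 ∧ ∀ j, 0 < p'.2 j) → p ≤ p' → p ≠ p' → g p' < g p)
    (hfconv : StrictConvexOn ℝ {u : Fin m → ℝ | ∀ i, 0 < u i} f)
    (hgconv : StrictConvexOn ℝ {p : ℝ × (Fin k → ℝ) | 0 < p.1 ∧ ∀ j, 0 < p.2 j} g)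
    (a : Fin m → ℝ) (ha : ∀ i, 0 < a i) (c : ℝ) (hc : 0 < c)
    (h : (Fin m → ℝ) × (Fin k → ℝ) → ℝ)
    (hh : h = fun p => g (c + f a - f p.1, p.2))
    (D : Set ((Fin m → ℝ) × (Fin k → ℝ)))
    (hD : D = {p | (∀ i, 0 < p.1 i) ∧ (∀ j, 0 < p.2 j) ∧ 0 < c + f a - f p.1}) :
    ContDiffOn ℝ 2 h D ∧ StrictConvexOn ℝ D h ∧
    (∀ p p' : (Fin m → ℝ) × (Fin k → ℝ), ∀ z z' : ℝ,
      p ∈ D → p' ∈ D → p ≤ p' → z ≤ z' → (p, z) ≠ (p', z') →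
      z - h p < z' - h p') := by
  subst hh hD
  refine ⟨?_, ?_, ?_⟩
  · refine hg.comp (ContDiffOn.prodMk (contDiffOn_const.sub
      (hf.comp contDiff_fst.contDiffOn fun p hp => hp.1)) contDiff_snd.contDiffOn)
      fun p hp => ⟨hp.2.2, hp.2.1⟩
  · refine StrictConvexOn.comp_const_sub_fst (t := {y : Fin k → ℝ | ∀ j, 0 < y j}) (c + f a)
      hfconv hgconv ?_ ?_
    · intro y hy y' hy' α β hα hβ hαβ j
      exact convex_Ioi (0 : ℝ) (hy j) (hy' j) hα hβ hαβ
    · intro y hy w hw w' hw' hlt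
      exact hgdec _ _ ⟨hw, hy⟩ ⟨hw', hy⟩ ⟨hlt.le, le_rfl⟩ fun h => hlt.ne (congrArg Prod.fst h)
  · rintro ⟨x, y⟩ ⟨x', y'⟩ z z' ⟨hx, hy, hw⟩ ⟨hx', hy', hw'⟩ ⟨hxx, hyy⟩ hz hne
    dsimp only at *
    by_cases heq : (c + f a - f x, y) = (c + f a - f x', y')
    · obtain ⟨hfeq, rfl⟩ := Prod.mk.inj heq
      have hx_eq : x = x' := by
        by_contra hxne
        linarith [hfdec x x' hx hx' hxx hxne]
      subst hx_eq
      have : z ≠ z' := fun h => hne (by rw [h])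
      linarith [lt_of_le_of_ne hz this]
    · have hfle : f x' ≤ f x := by
        rcases eq_or_ne x x' with rfl | hxne
        · exact le_rfl
        · exact (hfdec x x' hx hx' hxx hxne).le
      have := hgdec _ _ ⟨hw, hy⟩ ⟨hw', hy'⟩ ⟨sub_le_sub_left hfle _, hyy⟩ heq
      linarith
end

section
/- Let f : ℝ_{>0}^m → ℝ_{>0} and g : ℝ_{>0} × ℝ_{>0}^{n−1} → ℝ_{>0} be twice continuously differentiable, strictly decreasing, and strictly convex. Let (v, w, v') be a valuation with v ∈ ℝ_{>0}^m, w ∈ ℝ_{>0}, v' ∈ ℝ_{>0}^n, all entries in (0,1) and total sum 1; write v' = (v'_{1..n−1}, v'_n). Suppose a* ∈ ℝ_{>0}^m is a stable point of (x, f(x)) for (v, w): v·a* + w·f(a*) < v·x + w·f(x) for all x ≠ a*; and (c, b*) ∈ ℝ_{>0} × ℝ_{>0}^{n−1} is a stable point of (z, y, g(z, y)) for (w, v'): w·c + v'_{1..n−1}·b* + v'_n·g(c, b*) < w·z + v'_{1..n−1}·y + v'_n·g(z, y) for all (z, y) ≠ (c, b*). Then, with h(x, y) = g(c + f(a*) −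 f(x), y), the point (a*, b*) is a stable point of the composed surface (x, y, h(x, y)) for (v, v'): v·a* + v'_{1..n−1}·b* + v'_n·h(a*, b*) < v·x + v'_{1..n−1}·y + v'_n·h(x, y) for all (x, y) ≠ (a*, b*) in the domain of h. -/
open Finset

/-- Stable points under many-to-one sequential composition (here `k = n - 1`):
if `a*` is a stable point of `(x, f(x))` for weights `(v, w)` and `(c, b*)` is
a stable point of `(z, y, g(z, y))` for weights `(w, v')`, with `v'` split as
`(v'₁, v'ₙ)`, then `(a*, b*)` is a stable point of the composed surface
`(x, y, h(x, y))`, `h(x, y) = g(c + f(a*) - f(x), y)`, for weights `(v, v')`. -/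
theorem many_to_one_composition_stable_point (m k : ℕ)
    (f : (Fin m → ℝ) → ℝ) (g : ℝ × (Fin k → ℝ) → ℝ)
    (hfpos : ∀ u : Fin m → ℝ, (∀ i, 0 < u i) → 0 < f u)
    (hgpos : ∀ p : ℝ × (Fin k → ℝ), 0 < p.1 → (∀ j, 0 < p.2 j) → 0 < g p)
    (hf : ContDiffOn ℝ 2 f {u : Fin m → ℝ | ∀ i, 0 < u i})
    (hg : ContDiffOn ℝ 2 g {p : ℝ × (Fin k → ℝ) | 0 < p.1 ∧ ∀ j, 0 < p.2 j})
    (hfdec : ∀ u u' : Fin m → ℝ, (∀ i, 0 < u i) → (∀ i, 0 < u' i) →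
      u ≤ u' → u ≠ u' → f u' < f u)
    (hgdec : ∀ p p' : ℝ × (Fin k → ℝ), (0 < p.1 ∧ ∀ j, 0 < p.2 j) →
      (0 < p'.1 ∧ ∀ j, 0 < p'.2 j) → p ≤ p' → p ≠ p' → g p' < g p)
    (hfconv : StrictConvexOn ℝ {u : Fin m → ℝ | ∀ i, 0 < u i} f)
    (hgconv : StrictConvexOn ℝ {p : ℝ × (Fin k → ℝ) | 0 < p.1 ∧ ∀ j, 0 < p.2 j} g)
    -- the valuation (v, w, v') with v' = (v'₁, v'ₙ)
    (v : Fin m → ℝ) (w : ℝ) (v'₁ : Fin k → ℝ) (v'ₙ : ℝ)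
    (hv : ∀ i, 0 < v i ∧ v i < 1) (hw : 0 < w ∧ w < 1)
    (hv'₁ : ∀ j, 0 < v'₁ j ∧ v'₁ j < 1) (hv'ₙ : 0 < v'ₙ ∧ v'ₙ < 1)
    (hsum : (∑ i, v i) + w + (∑ j, v'₁ j) + v'ₙ = 1)
    -- the states and stability hypotheses
    (astar : Fin m → ℝ) (hastar : ∀ i, 0 < astar i)
    (c : ℝ) (hc : 0 < c) (bstar : Fin k → ℝ) (hbstar : ∀ j, 0 < bstar j)
    (hstableA : ∀ x : Fin m → ℝ, (∀ i, 0 < x i) → x ≠ astar →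
      (∑ i, v i * astar i) + w * f astar < (∑ i, v i * x i) + w * f x)
    (hstableB : ∀ (z : ℝ) (y : Fin k → ℝ), 0 < z → (∀ j, 0 < y j) →
      (z, y) ≠ (c, bstar) →
      w * c + (∑ j, v'₁ j * bstar j) + v'ₙ * g (c, bstar)
        < w * z + (∑ j, v'₁ j * y j) + v'ₙ * g (z, y))
    (h : (Fin m → ℝ) × (Fin k → ℝ) → ℝ)
    (hh : h = fun p => g (c + f astar - f p.1, p.2)) :
    ∀ (x : Fin m → ℝ) (y : Fin k → ℝ), (∀ i, 0 < x i) → (∀ j, 0 < y j) →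
      0 < c + f astar - f x → (x, y) ≠ (astar, bstar) →
      (∑ i, v i * astar i) + (∑ j, v'₁ j * bstar j) + v'ₙ * h (astar, bstar)
        < (∑ i, v i * x i) + (∑ j, v'₁ j * y j) + v'ₙ * h (x, y) := by
  subst hh
  intro x y hx hy hz hne
  have hcc : c + f astar - f astar = c := by ring
  simp only [hcc]
  by_cases hxa : x = astar
  · subst hxa
    have hyb : (c, y) ≠ (c, bstar) := fun e => hne (congrArg (Prod.mk x) (congrArg Prod.snd e))
    have hB := hstableB c y hc hy hyb
    simp only [hcc]
    linarith
  · have hA := hstableA x hx hxa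
    have hB : w * c + (∑ j, v'₁ j * bstar j) + v'ₙ * g (c, bstar)
        ≤ w * (c + f astar - f x) + (∑ j, v'₁ j * y j)
          + v'ₙ * g (c + f astar - f x, y) := by
      by_cases hzy : (c + f astar - f x, y) = (c, bstar)
      · obtain ⟨hzc, hyb⟩ := Prod.ext_iff.mp hzy
        dsimp only at hzc hyb
        rw [hzc, hyb]
      · exact (hstableB _ y hz hy hzy).le
    linarith
end

section
/- Let f, g : ℝ_{>0} → ℝ_{>0} be twice continuously differentiable, strictly decreasing, and strictly convex, let a, b ∈ ℝ_{>0}, and let t ∈ (0, 1). Define the parallel composition h(x) = f(a + t·x) + g(b + (1−t)·x) on the set D = {x : a + t·x > 0 and b + (1−t)·x > 0}. Then h is twice continuously differentiable, strictly decreasing, and strictly convex on D; equivalently, (B‖C)(x, y) = y − h(x) is twice differentiable and strictly increasing, and its upper contour set {(x, y) : x ∈ D, y > 0, y ≥ h(x)} is strictly convex. -/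
open Set

theorem ContDiffOn.comp_const_add_const_mul {f : ℝ → ℝ} {n : WithTop ℕ∞} {s : Set ℝ}
    (hf : ContDiffOn ℝ n f s) (c m : ℝ) :
    ContDiffOn ℝ n (fun x => f (c + m * x)) {x | c + m * x ∈ s} :=
  hf.comp (by fun_prop) fun _ hx => hx

theorem StrictAntiOn.comp_const_add_const_mul {f : ℝ → ℝ} {s : Set ℝ}
    (hf : StrictAntiOn f s) (c : ℝ) {m : ℝ} (hm : 0 < m) :
    StrictAntiOn (fun x => f (c + m * x)) {x | c + m * x ∈ s} :=
  fun _ hx _ hy hxy => hf hx hy (by gcongr)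

theorem StrictConvexOn.comp_const_add_const_mul {f : ℝ → ℝ} {s : Set ℝ}
    (hf : StrictConvexOn ℝ s f) (c : ℝ) {m : ℝ} (hm : m ≠ 0) :
    StrictConvexOn ℝ {x | c + m * x ∈ s} (fun x => f (c + m * x)) := by
  have affine_comb : ∀ {p q : ℝ} (x y : ℝ), p + q = 1 →
      c + m * (p • x + q • y) = p • (c + m * x) + q • (c + m * y) := by
    intro p q x y hpq
    simp only [smul_eq_mul]
    linear_combination (-c) * hpq
  refine ⟨fun x hx y hy p q hp hq hpq => ?_, fun x hx y hy hxy p q hp hq hpq => ?_⟩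
  · rw [mem_ofPred_eq, affine_comb x y hpq]
    exact hf.1 hx hy hp hq hpq
  · simp only [affine_comb x y hpq]
    exact hf.2 hx hy (by simpa [hm] using hxy) hp hq hpq

/-- Parallel composition of two 2-dimensional AMMs in explicit form: if
`f, g : ℝ_{>0} → ℝ_{>0}` are C², strictly decreasing and strictly convex, and
`t ∈ (0, 1)`, then `h(x) = f(a + t·x) + g(b + (1-t)·x)` is C², strictly
decreasing and strictly convex on `D = {x | a + t·x > 0 ∧ b + (1-t)·x > 0}`. -/
theorem parallel_composition_is_AMM
    (f g : ℝ → ℝ) (a b : ℝ) (ha : 0 < a) (hb : 0 < b)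
    (t : ℝ) (ht : 0 < t ∧ t < 1)
    (hfpos : ∀ x ∈ Set.Ioi (0 : ℝ), 0 < f x)
    (hgpos : ∀ y ∈ Set.Ioi (0 : ℝ), 0 < g y)
    (hf : ContDiffOn ℝ 2 f (Set.Ioi 0)) (hg : ContDiffOn ℝ 2 g (Set.Ioi 0))
    (hfdec : StrictAntiOn f (Set.Ioi 0)) (hgdec : StrictAntiOn g (Set.Ioi 0))
    (hfconv : StrictConvexOn ℝ (Set.Ioi 0) f)
    (hgconv : StrictConvexOn ℝ (Set.Ioi 0) g)
    (h : ℝ → ℝ) (hh : h = fun x => f (a + t * x) + g (b + (1 - t) * x))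
    (D : Set ℝ) (hD : D = {x : ℝ | 0 < a + t * x ∧ 0 < b + (1 - t) * x}) :
    ContDiffOn ℝ 2 h D ∧ StrictAntiOn h D ∧ StrictConvexOn ℝ D h := by
  subst hh hD
  obtain ⟨ht0, ht1⟩ := ht
  have ht1' : 0 < 1 - t := sub_pos.mpr ht1
  have hDf : {x : ℝ | 0 < a + t * x ∧ 0 < b + (1 - t) * x} ⊆ {x | a + t * x ∈ Ioi 0} :=
    fun _ hx => hx.1
  have hDg : {x : ℝ | 0 < a + t * x ∧ 0 < b + (1 - t) * x} ⊆ {x | b + (1 - t) * x ∈ Ioi 0} :=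
    fun _ hx => hx.2
  have hf' := hfconv.comp_const_add_const_mul a ht0.ne'
  have hg' := hgconv.comp_const_add_const_mul b ht1'.ne'
  have hDconv : Convex ℝ {x : ℝ | 0 < a + t * x ∧ 0 < b + (1 - t) * x} := hf'.1.inter hg'.1
  exact ⟨((hf.comp_const_add_const_mul a t).mono hDf).add
      ((hg.comp_const_add_const_mul b (1 - t)).mono hDg),
    ((hfdec.comp_const_add_const_mul a ht0).mono hDf).add
      ((hgdec.comp_const_add_const_mul b ht1').mono hDg),
    (hf'.subset hDf hDconv).add (hg'.subset hDg hDconv)⟩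
end

section
/- Let f, g : ℝ_{>0} → ℝ_{>0} be twice continuously differentiable, strictly decreasing, and strictly convex, and let (v, 1−v) with 0 < v < 1 be a valuation. Suppose a ∈ ℝ_{>0} is a stable point of (x, f(x)) for (v, 1−v), i.e. v·a + (1−v)·f(a) < v·x + (1−v)·f(x) for all x ≠ a, and b ∈ ℝ_{>0} is a stable point of (y, g(y)) for (v, 1−v), i.e. v·b + (1−v)·g(b) < v·y + (1−v)·g(y) for all y ≠ b. Then for every t ∈ ℝ, setting h_t(x) = f(a + t·x) + g(b + (1−t)·x), the point 0 is a stable point of the parallel composition for (v, 1−v): v·0 + (1−v)·h_t(0) < v·x + (1−v)·h_t(x) for all x ≠ 0 with a + t·x > 0 and b + (1−t)·x > 0. -/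
/-- Stable points under parallel composition of 2-dimensional AMMs: if `a` and
`b` are stable points of `(x, f(x))` and `(y, g(y))` for the same valuation
`(v, 1-v)`, then for every split `t`, the point `0` is a stable point of the
parallel composition `h_t(x) = f(a + t·x) + g(b + (1-t)·x)` for `(v, 1-v)`. -/
theorem parallel_composition_stable_point
    (f g : ℝ → ℝ) (a b : ℝ) (ha : 0 < a) (hb : 0 < b)
    (hfpos : ∀ x ∈ Set.Ioi (0 : ℝ), 0 < f x)
    (hgpos : ∀ y ∈ Set.Ioi (0 : ℝ), 0 < g y)
    (hf : ContDiffOn ℝ 2 f (Set.Ioi 0)) (hg : ContDiffOn ℝ 2 g (Set.Ioi 0))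
    (hfdec : StrictAntiOn f (Set.Ioi 0)) (hgdec : StrictAntiOn g (Set.Ioi 0))
    (hfconv : StrictConvexOn ℝ (Set.Ioi 0) f)
    (hgconv : StrictConvexOn ℝ (Set.Ioi 0) g)
    (v : ℝ) (hv : 0 < v ∧ v < 1)
    (hstableA : ∀ x : ℝ, 0 < x → x ≠ a →
      v * a + (1 - v) * f a < v * x + (1 - v) * f x)
    (hstableB : ∀ y : ℝ, 0 < y → y ≠ b →
      v * b + (1 - v) * g b < v * y + (1 - v) * g y) :
    ∀ t : ℝ, ∀ ht : ℝ → ℝ,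
      ht = (fun x => f (a + t * x) + g (b + (1 - t) * x)) →
      ∀ x : ℝ, x ≠ 0 → 0 < a + t * x → 0 < b + (1 - t) * x →
        v * 0 + (1 - v) * ht 0 < v * x + (1 - v) * ht x := by
  rintro t ht rfl x hx hxa hxb
  have hA : v * a + (1 - v) * f a ≤ v * (a + t * x) + (1 - v) * f (a + t * x) := by
    by_cases h : a + t * x = a
    · rw [h]
    · exact (hstableA _ hxa h).le
  by_cases h : b + (1 - t) * x = b
  · have hne : a + t * x ≠ a := fun h' => hx (by linarith)
    have hA' := hstableA _ hxa hne
    simp only [mul_zero, add_zero, h]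
    have hsplit : t * x = x := by linarith
    rw [hsplit] at hA' ⊢
    linarith
  · have hB := hstableB _ hxb h
    simp only [mul_zero, add_zero]
    linarith
end

section
/- Let f, g : ℝ_{>0}^{n−1} → ℝ_{>0} be twice continuously differentiable, strictly decreasing in each coordinate, and strictly convex, and let (v, 1−‖v‖₁) be a valuation with v ∈ ℝ_{>0}^{n−1} and ‖v‖₁ = Σ_i v_i < 1. Suppose a ∈ ℝ_{>0}^{n−1} is a stable point of (x, f(x)) for (v, 1−‖v‖₁): v·a + (1−‖v‖₁)·f(a) < v·x + (1−‖v‖₁)·f(x) for all x ≠ a; and b ∈ ℝ_{>0}^{n−1} is a stable point of (y, g(y)) for (v, 1−‖v‖₁): v·b + (1−‖v‖₁)·g(b) < v·y + (1−‖v‖₁)·g(y) for all y ≠ b. Then for every t ∈ ℝ^{n−1}, setting h_t(x) = f(a + t∗x) + g(b + (1−t)∗x) where ∗ denotes componentwise multiplication, the point 0 is a stable point of the parallel composition for (v, 1−‖v‖₁): v·0 + (1−‖v‖₁)·h_t(0) < v·x + (1−‖v‖₁)·h_t(x) for all x ≠ 0 with a + t∗x ∈ ℝ_{>0}^{n−1}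 and b + (1−t)∗x ∈ ℝ_{>0}^{n−1}. -/
open Finset

/-- Stable points under parallel composition of `n`-dimensional AMMs (here
`k = n - 1`): if `a` and `b` are stable points of `(x, f(x))` and `(y, g(y))`
for the same valuation `(v, 1 - ‖v‖₁)`, then for every split vector `t`, the
point `0` is a stable point of the parallel composition
`h_t(x) = f(a + t∗x) + g(b + (1-t)∗x)` (with `∗` componentwise multiplication)
for `(v, 1 - ‖v‖₁)`. -/
theorem parallel_composition_stable_point_multi (k : ℕ)
    (f g : (Fin k → ℝ) → ℝ)
    (hfpos : ∀ u : Fin k → ℝ, (∀ i, 0 < u i) → 0 < f u)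
    (hgpos : ∀ u : Fin k → ℝ, (∀ i, 0 < u i) → 0 < g u)
    (hf : ContDiffOn ℝ 2 f {u : Fin k → ℝ | ∀ i, 0 < u i})
    (hg : ContDiffOn ℝ 2 g {u : Fin k → ℝ | ∀ i, 0 < u i})
    (hfdec : ∀ u u' : Fin k → ℝ, (∀ i, 0 < u i) → (∀ i, 0 < u' i) →
      u ≤ u' → u ≠ u' → f u' < f u)
    (hgdec : ∀ u u' : Fin k → ℝ, (∀ i, 0 < u i) → (∀ i, 0 < u' i) →
      u ≤ u' → u ≠ u' → g u' < g u)
    (hfconv : StrictConvexOn ℝ {u : Fin k → ℝ | ∀ i, 0 < u i} f)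
    (hgconv : StrictConvexOn ℝ {u : Fin k → ℝ | ∀ i, 0 < u i} g)
    (v : Fin k → ℝ) (hv : ∀ i, 0 < v i) (hv1 : ∑ i, v i < 1)
    (a b : Fin k → ℝ) (ha : ∀ i, 0 < a i) (hb : ∀ i, 0 < b i)
    (hstableA : ∀ x : Fin k → ℝ, (∀ i, 0 < x i) → x ≠ a →
      (∑ i, v i * a i) + (1 - ∑ i, v i) * f a
        < (∑ i, v i * x i) + (1 - ∑ i, v i) * f x)
    (hstableB : ∀ y : Fin k → ℝ, (∀ i, 0 < y i) → y ≠ b →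
      (∑ i, v i * b i) + (1 - ∑ i, v i) * g b
        < (∑ i, v i * y i) + (1 - ∑ i, v i) * g y) :
    ∀ t : Fin k → ℝ, ∀ ht : (Fin k → ℝ) → ℝ,
      ht = (fun x => f (a + t * x) + g (b + (1 - t) * x)) →
      ∀ x : Fin k → ℝ, x ≠ 0 →
        (∀ i, 0 < a i + t i * x i) → (∀ i, 0 < b i + (1 - t i) * x i) →
        (∑ i, v i * (0 : ℝ)) + (1 - ∑ i, v i) * ht 0
          < (∑ i, v i * x i) + (1 - ∑ i, v i) * ht x := by
  rintro t ht rfl x hx hax hbx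
  have hsum : (∑ i, v i * (a + t * x) i) + (∑ i, v i * (b + (1 - t) * x) i)
      = (∑ i, v i * a i) + (∑ i, v i * b i) + ∑ i, v i * x i := by
    simp only [← Finset.sum_add_distrib]
    refine Finset.sum_congr rfl fun i _ => ?_
    simp only [Pi.add_apply, Pi.mul_apply, Pi.sub_apply, Pi.one_apply]
    ring
  have hA : a + t * x ≠ a → _ := hstableA (a + t * x) hax
  have hB : b + (1 - t) * x ≠ b → _ := hstableB (b + (1 - t) * x) hbx
  simp only [mul_zero, add_zero, Finset.sum_const_zero, zero_add, mul_add]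
  by_cases hxa : a + t * x = a
  · have hxb : b + (1 - t) * x ≠ b := by
      intro hxb
      apply hx
      have h1 : t * x = 0 := add_eq_left.mp hxa
      have h2 : (1 - t) * x = 0 := add_eq_left.mp hxb
      calc x = t * x + (1 - t) * x := by ring
        _ = 0 := by rw [h1, h2, add_zero]
    have := hB hxb
    rw [hxa] at hsum ⊢
    linarith
  · have hA' := hA hxa
    by_cases hxb : b + (1 - t) * x = b
    · rw [hxb] at hsum ⊢
      linarith
    · have := hB hxb
      linarith
end
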